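/- arXiv:math/0510132 — 3 statements merged into one kernel-verified Lean document; each statement's English description precedes it below -/
import Mathlib

section
/- Let n ≥ m be natural numbers and let g(x) = a_m x^m + ... + a_1 x + a_0 be a polynomial with integer coefficients. Then the sum over k from 0 to n of g(k) · C(n, k) · d(n-k) equals (∑_{i=0}^{m} a_i B_i) · n!, where B_i is the i-th Bell number. -/
/-- The `i`-th Bell number: the number of partitions of an `i`-element set into
nonempty subsets. -/
def bellNumber (i : ℕ) : ℕ :=
  Fintype.card (Finpartition (Finset.univ : Finset (Fin i)))

/-- Finpartitions of a finite type correspond to equivalence relations on it. -/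
noncomputable def finpartitionUnivEquivSetoid (α : Type*) [Fintype α] [DecidableEq α] :
    Finpartition (Finset.univ : Finset α) ≃ Setoid α := by
  classical
  exact
  { toFun := fun P => Setoid.ker P.part
    invFun := fun s => Finpartition.ofSetoid s
    left_inv := fun P => by
      have hpart : ∀ a, (Finpartition.ofSetoid (Setoid.ker P.part)).part a = P.part a := by
        intro a
        ext b
        rw [Finpartition.mem_part_ofSetoid_iff_rel, Setoid.ker_def,
          P.mem_part_iff_part_eq_part (Finset.mem_univ b) (Finset.mem_univ a), eq_comm]
      have hparts : ∀ (Q : Finpartition (Finset.univ : Finset α)) (t : Finset α),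
          t ∈ Q.parts ↔ ∃ a, Q.part a = t := by
        refine fun Q t => ⟨fun ht => ?_, ?_⟩
        · obtain ⟨a, ha⟩ := Q.nonempty_of_mem_parts ht
          exact ⟨a, Q.part_eq_of_mem ht ha⟩
        · rintro ⟨a, rfl⟩
          exact Q.part_mem.2 (Finset.mem_univ a)
      ext t
      simp only [hparts, hpart]
    right_inv := fun s => by
      ext a b
      rw [Setoid.ker_def, ← Finpartition.mem_part_iff_part_eq_part _ (Finset.mem_univ a)
        (Finset.mem_univ b), Finpartition.mem_part_ofSetoid_iff_rel, Setoid.comm'] }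

/-- Two functions into a finite type with the same kernel differ by a permutation of the
codomain. -/
theorem exists_perm_smul_eq_of_ker_eq {α β : Type*} [Finite β] {f g : α → β}
    (h : Setoid.ker f = Setoid.ker g) : ∃ σ : Equiv.Perm β, σ • g = f := by
  classical
  have := Fintype.ofFinite β
  let e : Set.range g ≃ Set.range f :=
    (Setoid.quotientKerEquivRange g).symm.trans
      ((Quotient.congrRight fun a b => by rw [h]).trans (Setoid.quotientKerEquivRange f))
  have he : ∀ x, e ⟨g x, x, rfl⟩ = ⟨f x, x, rfl⟩ := by
    intro x
    have hx : (Setoid.quotientKerEquivRange g).symm ⟨g x, x, rfl⟩ = Quotient.mk _ x := by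
      rw [Equiv.symm_apply_eq]
      rfl
    simp only [e, Equiv.trans_apply, hx]
    rfl
  refine ⟨Equiv.extendSubtype (p := (· ∈ Set.range g)) (q := (· ∈ Set.range f)) e, ?_⟩
  ext x
  rw [Pi.smul_apply, Equiv.Perm.smul_def, Equiv.extendSubtype_apply_of_mem _ _ ⟨x, rfl⟩]
  exact congrArg Subtype.val (he x)

/-- If `α` is no larger than `β`, the orbits of the permutations of `β` acting on functions
`α → β` correspond to the equivalence relations on `α`. -/
noncomputable def orbitsPermArrowEquivSetoid (α β : Type*) [Fintype α] [Fintype β]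
    (h : Fintype.card α ≤ Fintype.card β) :
    Quotient (MulAction.orbitRel (Equiv.Perm β) (α → β)) ≃ Setoid α :=
  Equiv.ofBijective
    (Quotient.lift (fun f : α → β => Setoid.ker f) (by
      rintro _ g ⟨σ, rfl⟩
      ext a b
      simp [Setoid.ker_def]))
    (by
      constructor
      · rintro ⟨f⟩ ⟨g⟩ hfg
        exact Quotient.sound (exists_perm_smul_eq_of_ker_eq hfg)
      · intro s
        classical
        obtain ⟨e⟩ : Nonempty (Quotient s ↪ β) :=
          Function.Embedding.nonempty_of_card_le ((Fintype.card_quotient_le s).trans h)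
        refine ⟨Quotient.mk _ (fun a => e (Quotient.mk s a)), ?_⟩
        ext a b
        exact e.injective.eq_iff.trans Quotient.eq)

/-- The permutations whose set of fixed points is exactly `s` are counted by derangements. -/
theorem card_filter_fixedPoints_eq {α : Type*} [Fintype α] [DecidableEq α] (s : Finset α) :
    (Finset.univ.filter fun σ : Equiv.Perm α =>
      (Finset.univ.filter fun x => σ x = x) = s).card =
      numDerangements (Fintype.card α - s.card) := by
  classical
  have hs : Fintype.card {x // x ∉ s} = Fintype.card α - s.card := by
    rw [Fintype.card_subtype_compl, Fintype.card_coe]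
  rw [← hs, ← card_derangements_eq_numDerangements,
    Fintype.card_congr (derangements.subtypeEquiv fun x => x ∉ s), ← Fintype.card_subtype]
  refine Fintype.card_congr (Equiv.subtypeEquivRight fun σ => ?_)
  simp only [Finset.ext_iff, Finset.mem_filter, Finset.mem_univ, true_and, not_not,
    Function.mem_fixedPoints, Function.IsFixedPt]
  exact forall_congr' fun a => Iff.comm

theorem card_filter_card_fixedPoints_eq {α : Type*} [Fintype α] [DecidableEq α] (k : ℕ) :
    (Finset.univ.filter fun σ : Equiv.Perm α =>
      (Finset.univ.filter fun x => σ x = x).card = k).card =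
      (Fintype.card α).choose k * numDerangements (Fintype.card α - k) := by
  rw [Finset.card_eq_sum_card_fiberwise
    (f := fun σ : Equiv.Perm α => Finset.univ.filter fun x => σ x = x)
    (t := Finset.univ.powersetCard k) (fun σ hσ => by simpa using hσ)]
  rw [Finset.sum_congr rfl (g := fun _ => numDerangements (Fintype.card α - k)),
    Finset.sum_const, Finset.card_powersetCard, Finset.card_univ, smul_eq_mul]
  intro s hs
  obtain rfl := (Finset.mem_powersetCard.1 hs).2
  rw [← card_filter_fixedPoints_eq, Finset.filter_filter]
  congr 1
  ext σ
  simp only [Finset.mem_filter, Finset.mem_univ, true_and, and_iff_right_iff_imp]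
  exact congrArg Finset.card

theorem sum_perm_card_fixedPoints_pow (i n : ℕ) (h : i ≤ n) :
    ∑ σ : Equiv.Perm (Fin n), (Finset.univ.filter fun x => σ x = x).card ^ i =
      bellNumber i * n.factorial := by
  classical
  have burnside := MulAction.sum_card_fixedBy_eq_card_orbits_mul_card_group
    (Equiv.Perm (Fin n)) (Fin i → Fin n)
  rw [Fintype.card_perm, Fintype.card_fin] at burnside
  have horbits : bellNumber i =
      Fintype.card (Quotient (MulAction.orbitRel (Equiv.Perm (Fin n)) (Fin i → Fin n))) :=
    Fintype.card_congr ((finpartitionUnivEquivSetoid (Fin i)).trans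
      (orbitsPermArrowEquivSetoid (Fin i) (Fin n) (by simpa using h)).symm)
  rw [horbits, ← burnside]
  refine Finset.sum_congr rfl fun σ _ => ?_
  have hfixed : MulAction.fixedBy (Fin i → Fin n) σ = {f | ∀ j, σ (f j) = f j} := by
    ext f
    simp [MulAction.mem_fixedBy, funext_iff]
  rw [Fintype.card_congr ((Equiv.setCongr hfixed).trans
    (Equiv.subtypePiEquivPi (p := fun (_ : Fin i) x => σ x = x))), Fintype.card_pi_const,
    Fintype.card_subtype]

theorem sum_pow_mul_choose_mul_numDerangements (i n : ℕ) (h : i ≤ n) :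
    ∑ k ∈ Finset.range (n + 1), k ^ i * (n.choose k * numDerangements (n - k)) =
      bellNumber i * n.factorial := by
  rw [← sum_perm_card_fixedPoints_pow i n h,
    ← Finset.sum_fiberwise_of_maps_to (t := Finset.range (n + 1))
      (g := fun σ : Equiv.Perm (Fin n) => (Finset.univ.filter fun x => σ x = x).card)
      (fun σ _ => Finset.mem_range_succ_iff.2 ((Finset.card_le_univ _).trans (by simp)))]
  refine Finset.sum_congr rfl fun k _ => ?_
  rw [Finset.sum_congr rfl (g := fun _ => k ^ i)
    (fun σ hσ => by rw [(Finset.mem_filter.1 hσ).2]), Finset.sum_const,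
    card_filter_card_fixedPoints_eq, Fintype.card_fin, smul_eq_mul, mul_comm]

/-- Let `n ≥ m` and let `g(x) = a_m x^m + ⋯ + a_1 x + a_0` be a polynomial with
integer coefficients. Then `∑_{k=0}^n g(k) · C(n,k) · d(n-k) = (∑_{i=0}^m a_i B_i) · n!`,
where `B_i` is the `i`-th Bell number and `d` is the number of derangements. -/
theorem sum_poly_mul_choose_mul_numDerangements (m n : ℕ) (h : m ≤ n) (a : ℕ → ℤ) :
    ∑ k ∈ Finset.range (n + 1),
      (∑ i ∈ Finset.range (m + 1), a i * (k : ℤ) ^ i) *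
        (n.choose k * numDerangements (n - k) : ℤ) =
      (∑ i ∈ Finset.range (m + 1), a i * bellNumber i) * n.factorial := by
  simp only [Finset.sum_mul]
  rw [Finset.sum_comm]
  refine Finset.sum_congr rfl fun i hi => ?_
  have hin : i ≤ n := (Finset.mem_range_succ_iff.1 hi).trans h
  have key := congrArg (Nat.cast : ℕ → ℤ) (sum_pow_mul_choose_mul_numDerangements i n hin)
  push_cast at key
  simp only [mul_assoc, ← Finset.mul_sum]
  rw [key]
end

section
/- For all natural numbers n and k with k ≥ 1, the number of permutations of {1,...,n+1} with exactly k fixed points satisfies the recursion f_{n+1}(k) = f_n(k-1) + (n-k) · f_n(k) + (k+1) · f_n(k+1), where f_n(j) denotes the number of permutations of an n-element set having exactly j fixed points (with f_n(j) = 0 when j > n). -/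
/-- `f n j` is the number of permutations of an `n`-element set with exactly `j`
fixed points. -/
def numPermsWithFixedPoints (n j : ℕ) : ℕ :=
  ((Finset.univ : Finset (Equiv.Perm (Fin n))).filter
    (fun σ => (Finset.univ.filter fun i => σ i = i).card = j)).card

open Finset Equiv in
theorem card_fixedPoints_decomposeFin_symm_zero {n : ℕ} (e : Perm (Fin n)) :
    #{i | Perm.decomposeFin.symm (0, e) i = i} = #{i | e i = i} + 1 := by
  rw [Fin.univ_succ, filter_cons]
  simp [filter_map]

open Finset Equiv in
theorem card_fixedPoints_decomposeFin_symm_succ {n : ℕ} (e : Perm (Fin n)) (j : Fin n) :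
    #{i | Perm.decomposeFin.symm (j.succ, e) i = i} =
      #(({i | e i = i} : Finset (Fin n)).erase j) := by
  rw [Fin.univ_succ, filter_cons]
  have key (i : Fin n) : swap 0 j.succ (e i).succ = i.succ ↔ i ≠ j ∧ e i = i := by
    by_cases h : e i = j
    · rw [h, swap_apply_right]
      simpa [(Fin.succ_ne_zero i).symm] using fun h₁ h₂ => h₁ h₂.symm
    · rw [swap_apply_of_ne_of_ne (Fin.succ_ne_zero _) (by simpa using h), Fin.succ_inj]
      exact ⟨fun hi => ⟨fun hij => h (hi.trans hij), hi⟩, And.right⟩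
  simp only [filter_map, Function.comp_def, Function.Embedding.coeFn_mk,
    Perm.decomposeFin_symm_apply_zero, Fin.succ_ne_zero, if_false, card_map,
    Perm.decomposeFin_symm_apply_succ, key]
  congr 1
  ext i
  simp

open Finset in
theorem Finset.card_filter_card_erase_eq {α : Type*} [Fintype α] [DecidableEq α]
    (s : Finset α) (k : ℕ) :
    #{a | #(s.erase a) = k} =
      (Fintype.card α - k) * (if #s = k then 1 else 0) +
        (k + 1) * (if #s = k + 1 then 1 else 0) := by
  have key (a : α) : #(s.erase a) = k ↔ (a ∉ s ∧ #s = k) ∨ (a ∈ s ∧ #s = k + 1) := by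
    by_cases ha : a ∈ s
    · have := card_erase_add_one ha
      simp only [ha, not_true_eq_false, false_and, true_and, false_or]
      omega
    · simp [ha]
  simp only [key]
  by_cases h₁ : #s = k
  · simp [h₁, ← compl_filter, card_compl]
  · by_cases h₂ : #s = k + 1 <;> simp [h₁, h₂]

/-- For `k ≥ 1`, `f_{n+1}(k) = f_n(k-1) + (n-k)·f_n(k) + (k+1)·f_n(k+1)`. -/
theorem numPermsWithFixedPoints_succ (n k : ℕ) (hk : 1 ≤ k) :
    numPermsWithFixedPoints (n + 1) k =
      numPermsWithFixedPoints n (k - 1) + (n - k) * numPermsWithFixedPoints n k +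
        (k + 1) * numPermsWithFixedPoints n (k + 1) := by
  unfold numPermsWithFixedPoints
  simp only [Finset.card_filter _ (Finset.univ : Finset (Equiv.Perm (Fin _)))]
  rw [← Equiv.Perm.decomposeFin.symm.sum_comp, Fintype.sum_prod_type_right,
    Finset.mul_sum, Finset.mul_sum, ← Finset.sum_add_distrib, ← Finset.sum_add_distrib]
  refine Finset.sum_congr rfl fun e _ => ?_
  rw [Fin.sum_univ_succ, ← Finset.card_filter]
  simp only [card_fixedPoints_decomposeFin_symm_zero, card_fixedPoints_decomposeFin_symm_succ,
    Finset.card_filter_card_erase_eq, Fintype.card_fin, add_assoc, eq_tsub_iff_add_eq_of_le hk]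
end

section
/- For all natural numbers n and l with n ≥ l, the sum over k from 0 to n of the falling factorial [k]_l = k(k-1)···(k-l+1) times C(n, k) · d(n-k) equals n!. -/
/-- Sorting the permutations of an `n`-element set by their number of non-fixed points:
`∑_{j=0}^n C(n,j) · d(j) = n!`. -/
theorem sum_choose_mul_numDerangements (n : ℕ) :
    ∑ j ∈ Finset.range (n + 1), n.choose j * numDerangements j = n.factorial := by
  induction n with
  | zero => simp
  | succ n ih =>
    have hAlt := Int.alternating_sum_range_choose_of_ne (n := n + 1) n.succ_ne_zero
    rw [Finset.sum_range_succ'] at hAlt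
    zify at ih ⊢
    rw [Finset.sum_range_succ', Nat.factorial_succ]
    push_cast
    rw [← ih, Finset.mul_sum]
    have hTerm : ∀ j ∈ Finset.range (n + 1),
        ((n + 1).choose (j + 1) : ℤ) * numDerangements (j + 1) =
          (n + 1) * (n.choose j * numDerangements j) +
            (-1) ^ (j + 1) * ((n + 1).choose (j + 1) : ℤ) := by
      intro j _
      have hChoose : ((n : ℤ) + 1) * n.choose j = (n + 1).choose (j + 1) * (j + 1) := by
        exact_mod_cast Nat.add_one_mul_choose_eq n j
      rw [numDerangements_succ]
      linear_combination -(numDerangements j : ℤ) * hChoose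
    rw [Finset.sum_congr rfl hTerm, Finset.sum_add_distrib]
    simp only [pow_zero, Nat.choose_zero_right, Nat.cast_one, mul_one,
      numDerangements_zero] at hAlt ⊢
    linear_combination hAlt

/-- For `n ≥ l`, `∑_{k=0}^n [k]_l · C(n,k) · d(n-k) = n!`, where
`[k]_l = k(k-1)⋯(k-l+1)` is the falling factorial and `d` is the number of
derangements. -/
theorem sum_descFactorial_mul_choose_mul_numDerangements (n l : ℕ) (h : l ≤ n) :
    ∑ k ∈ Finset.range (n + 1),
      k.descFactorial l * n.choose k * numDerangements (n - k) = n.factorial := by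
  induction l generalizing n with
  | zero =>
    rw [← sum_choose_mul_numDerangements n, ← Finset.sum_range_reflect]
    refine Finset.sum_congr rfl fun k hk => ?_
    have hkn : k ≤ n := Nat.lt_succ_iff.mp (Finset.mem_range.mp hk)
    simp [Nat.choose_symm hkn, Nat.sub_sub_self hkn]
  | succ l ih =>
    obtain ⟨n, rfl⟩ : ∃ m, n = m + 1 := ⟨n - 1, by omega⟩
    rw [Finset.sum_range_succ', Nat.factorial_succ, ← ih n (by omega), Finset.mul_sum,
      Nat.zero_descFactorial_succ, zero_mul, zero_mul, add_zero]
    refine Finset.sum_congr rfl fun k _ => ?_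
    rw [Nat.succ_descFactorial_succ, Nat.add_sub_add_right]
    calc (k + 1) * k.descFactorial l * (n + 1).choose (k + 1) * numDerangements (n - k)
        = (n + 1).choose (k + 1) * (k + 1) * (k.descFactorial l * numDerangements (n - k)) := by
          ring
      _ = (n + 1) * (k.descFactorial l * n.choose k * numDerangements (n - k)) := by
          rw [← Nat.add_one_mul_choose_eq]
          ring
end
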